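/- arXiv:0912.2190 — 2 statements merged into one kernel-verified Lean document; each statement's English description precedes it below -/
import Mathlib

section
/- Let v be a complete Llull matrix on a finite set A, let ξ be an admissible order, and let v^π and m^π be the projected scores and projected margins. (a) Whenever x precedes y in ξ and z ∉ {x,y}: v^π_{xy} ≥ v^π_{yx} and m^π_{xy} ≥ 0; v^π_{xz} ≥ v^π_{yz} and v^π_{zx} ≤ v^π_{zy}; m^π_{xz} ≥ m^π_{yz} and m^π_{zx} ≤ m^π_{zy}. (b) If moreover v^π_{xy} = v^π_{yx} (equivalently m^π_{xy} = 0), then all the inequalities in the second and third groups hold with equality. -/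
/-! Common definitions: valued relations, indirect scores, admissible orders,
projected margins/scores, rank-like rates (Camps–Mora–Saumell CLC method). -/

variable {A : Type*} [Fintype A] [DecidableEq A]

/-- The score of a chain `x₀ :: x₁ :: ... :: xₙ`: the minimum of `v xᵢ xᵢ₊₁`
over its links (value `1` for chains with no link, which we never use). -/
noncomputable def linkScore (v : A → A → ℝ) : List A → ℝ
  | [] => 1
  | [_] => 1
  | [a, b] => v a b
  | a :: b :: c :: l => min (v a b) (linkScore v (b :: c :: l))

/-- The indirect score `v*_{xy}`: the supremum (= maximum) of the scores of all
paths from `x` to `y` (with at least one link, consecutive elements distinct). -/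
noncomputable def istar (v : A → A → ℝ) (x y : A) : ℝ :=
  sSup { s : ℝ | ∃ l : List A, List.Chain' (· ≠ ·) (x :: (l ++ [y])) ∧
      s = linkScore v (x :: (l ++ [y])) }

/-- `ξ` is a strict total order: irreflexive, transitive, total. -/
def StrictTotal (ξ : A → A → Prop) : Prop :=
  (∀ x, ¬ ξ x x) ∧ (∀ x y z, ξ x y → ξ y z → ξ x z) ∧ (∀ x y, x ≠ y → ξ x y ∨ ξ y x)

/-- `ξ` is admissible for `v`: `v*_{xy} > v*_{yx}` implies `x` precedes `y`. -/
def Adm (v : A → A → ℝ) (ξ : A → A → Prop) : Prop :=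
  ∀ x y, istar v x y > istar v y x → ξ x y

/-- Intermediate projected margin `m^σ_{xy}` (for `x` preceding `y` in `ξ`):
the infimum (= minimum) of the indirect margins `m*_{pq}` over `p ⪯ x`, `y ⪯ q`. -/
noncomputable def msigma (v : A → A → ℝ) (ξ : A → A → Prop) (x y : A) : ℝ :=
  sInf { s : ℝ | ∃ p q, (ξ p x ∨ p = x) ∧ (ξ y q ∨ q = y) ∧
      s = istar v p q - istar v q p }

/-- `q` is the immediate successor of `p` in `ξ`. -/
def ImmSucc (ξ : A → A → Prop) (p q : A) : Prop :=
  ξ p q ∧ ∀ z, ¬ (ξ p z ∧ ξ z q)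

/-- Projected margin (for `x` preceding `y` in `ξ`): the supremum (= maximum) of
`m^σ_{p p'}` over `x ⪯ p ≺ y`, `p'` the immediate successor of `p`. -/
noncomputable def mpiAux (v : A → A → ℝ) (ξ : A → A → Prop) (x y : A) : ℝ :=
  sSup { s : ℝ | ∃ p q, (ξ x p ∨ p = x) ∧ ξ p y ∧ ImmSucc ξ p q ∧
      s = msigma v ξ p q }

open Classical in
/-- Projected margins `m^π`, extended antisymmetrically. -/
noncomputable def mpi (v : A → A → ℝ) (ξ : A → A → Prop) (x y : A) : ℝ :=
  if ξ x y then mpiAux v ξ x y else - mpiAux v ξ y x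

/-- Projected scores `v^π_{xy} = (1 + m^π_{xy})/2`. -/
noncomputable def vpi (v : A → A → ℝ) (ξ : A → A → Prop) (x y : A) : ℝ :=
  (1 + mpi v ξ x y) / 2

/-- Rank-like rate `R_x = N - ∑_{y ≠ x} v^π_{xy}`. -/
noncomputable def rlr (v : A → A → ℝ) (ξ : A → A → Prop) (x : A) : ℝ :=
  (Fintype.card A : ℝ) - ∑ y ∈ Finset.univ.erase x, vpi v ξ x y

/-- `v` is a complete Llull matrix: scores of distinct pairs lie in `[0,1]`
and satisfy `v_{xy} + v_{yx} = 1`. -/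
def Llull (v : A → A → ℝ) : Prop :=
  ∀ x y : A, x ≠ y → 0 ≤ v x y ∧ v x y ≤ 1 ∧ v x y + v y x = 1

/-- Indirect margins are nonnegative along an admissible strict total order. -/
theorem istar_le_istar_of_adm {A : Type*} {v : A → A → ℝ} {ξ : A → A → Prop}
    (hξ : StrictTotal ξ) (hadm : Adm v ξ) {p q : A} (hpq : ξ p q) :
    istar v q p ≤ istar v p q := by
  by_contra! h
  exact hξ.1 p (hξ.2.1 p q p hpq (hadm q p h))

theorem msigma_nonneg {A : Type*} {v : A → A → ℝ} {ξ : A → A → Prop}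
    (hξ : StrictTotal ξ) (hadm : Adm v ξ) {x y : A} (hxy : ξ x y) :
    0 ≤ msigma v ξ x y := by
  refine Real.sInf_nonneg ?_
  rintro s ⟨p, q, hp, hq, rfl⟩
  have hpy : ξ p y := hp.elim (fun h => hξ.2.1 p x y h hxy) fun h => h ▸ hxy
  have hpq : ξ p q := hq.elim (hξ.2.1 p y q hpy) fun h => h ▸ hpy
  exact sub_nonneg.2 (istar_le_istar_of_adm hξ hadm hpq)

theorem mpiAux_nonneg {A : Type*} {v : A → A → ℝ} {ξ : A → A → Prop}
    (hξ : StrictTotal ξ) (hadm : Adm v ξ) (x y : A) : 0 ≤ mpiAux v ξ x y := by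
  refine Real.sSup_nonneg ?_
  rintro s ⟨p, q, -, -, hs, rfl⟩
  exact msigma_nonneg hξ hadm hs.1

theorem msigma_le_mpiAux {A : Type*} [Finite A] (v : A → A → ℝ) {ξ : A → A → Prop} {x y p q : A}
    (hxp : ξ x p ∨ p = x) (hpy : ξ p y) (hs : ImmSucc ξ p q) :
    msigma v ξ p q ≤ mpiAux v ξ x y := by
  refine le_csSup (Set.Finite.bddAbove ?_) ⟨p, q, hxp, hpy, hs, rfl⟩
  refine (Set.finite_range fun r : A × A => msigma v ξ r.1 r.2).subset ?_
  rintro s ⟨p, q, -, -, -, rfl⟩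
  exact ⟨(p, q), rfl⟩

theorem mpiAux_mono {A : Type*} [Finite A] {v : A → A → ℝ} {ξ : A → A → Prop}
    (hξ : StrictTotal ξ) (hadm : Adm v ξ) {x x' y y' : A}
    (hx : ξ x' x ∨ x = x') (hy : ξ y y' ∨ y = y') :
    mpiAux v ξ x y ≤ mpiAux v ξ x' y' := by
  refine Real.sSup_le ?_ (mpiAux_nonneg hξ hadm x' y')
  rintro s ⟨p, q, hp, hpy, hs, rfl⟩
  refine msigma_le_mpiAux v ?_ (hy.elim (hξ.2.1 p y y' hpy) fun h => h ▸ hpy) hs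
  rcases hx with hx | rfl
  · exact .inl (hp.elim (hξ.2.1 x' x p hx) fun h => h ▸ hx)
  · exact hp

theorem mpiAux_le_max {A : Type*} [Finite A] {v : A → A → ℝ} {ξ : A → A → Prop}
    (hξ : StrictTotal ξ) (hadm : Adm v ξ) (x y z : A) :
    mpiAux v ξ x z ≤ max (mpiAux v ξ x y) (mpiAux v ξ y z) := by
  refine Real.sSup_le ?_ (le_max_of_le_left (mpiAux_nonneg hξ hadm x y))
  rintro s ⟨p, q, hp, hpz, hs, rfl⟩
  by_cases hpy : ξ p y
  · exact le_max_of_le_left (msigma_le_mpiAux v hp hpy hs)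
  · refine le_max_of_le_right (msigma_le_mpiAux v ?_ hpz hs)
    by_cases h : p = y
    · exact .inr h
    · exact .inl ((hξ.2.2 p y h).resolve_left hpy)

theorem mpi_of_rel {A : Type*} (v : A → A → ℝ) {ξ : A → A → Prop} {x y : A} (h : ξ x y) :
    mpi v ξ x y = mpiAux v ξ x y := if_pos h

theorem mpi_of_rel_swap {A : Type*} (v : A → A → ℝ) {ξ : A → A → Prop} (hξ : StrictTotal ξ)
    {x y : A} (h : ξ x y) : mpi v ξ y x = -mpiAux v ξ x y :=
  if_neg fun h' => hξ.1 x (hξ.2.1 x y x h h')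

theorem mpi_swap {A : Type*} (v : A → A → ℝ) {ξ : A → A → Prop} (hξ : StrictTotal ξ)
    {x y : A} (h : x ≠ y) : mpi v ξ y x = -mpi v ξ x y := by
  rcases hξ.2.2 x y h with h | h
  · rw [mpi_of_rel v h, mpi_of_rel_swap v hξ h]
  · rw [mpi_of_rel v h, mpi_of_rel_swap v hξ h, neg_neg]

theorem mpi_nonneg {A : Type*} {v : A → A → ℝ} {ξ : A → A → Prop}
    (hξ : StrictTotal ξ) (hadm : Adm v ξ) {x y : A} (h : ξ x y) : 0 ≤ mpi v ξ x y :=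
  mpi_of_rel v h ▸ mpiAux_nonneg hξ hadm x y

theorem mpi_le_mpi_left {A : Type*} [Finite A] {v : A → A → ℝ} {ξ : A → A → Prop}
    (hξ : StrictTotal ξ) (hadm : Adm v ξ) {x y z : A} (hxy : ξ x y) (hzx : z ≠ x) (hzy : z ≠ y) :
    mpi v ξ y z ≤ mpi v ξ x z := by
  rcases hξ.2.2 z y hzy with hzy | hyz
  · rcases hξ.2.2 z x hzx with hzx | hxz
    · rw [mpi_of_rel_swap v hξ hzy, mpi_of_rel_swap v hξ hzx]
      exact neg_le_neg (mpiAux_mono hξ hadm (.inr rfl) (.inl hxy))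
    · have := mpi_nonneg hξ hadm hxz
      have := mpiAux_nonneg hξ hadm z y
      rw [mpi_of_rel_swap v hξ hzy]
      linarith
  · rw [mpi_of_rel v hyz, mpi_of_rel v (hξ.2.1 x y z hxy hyz)]
    exact mpiAux_mono hξ hadm (.inl hxy) (.inr rfl)

theorem mpi_eq_mpi_left {A : Type*} [Finite A] {v : A → A → ℝ} {ξ : A → A → Prop}
    (hξ : StrictTotal ξ) (hadm : Adm v ξ) {x y z : A} (hxy : ξ x y) (hzx : z ≠ x) (hzy : z ≠ y)
    (h : mpi v ξ x y = 0) : mpi v ξ x z = mpi v ξ y z := by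
  refine le_antisymm ?_ (mpi_le_mpi_left hξ hadm hxy hzx hzy)
  rw [mpi_of_rel v hxy] at h
  rcases hξ.2.2 z y hzy with hzy | hyz
  · rcases hξ.2.2 z x hzx with hzx | hxz
    · rw [mpi_of_rel_swap v hξ hzy, mpi_of_rel_swap v hξ hzx]
      refine neg_le_neg ((mpiAux_le_max hξ hadm z x y).trans ?_)
      rw [h, max_eq_left (mpiAux_nonneg hξ hadm z x)]
    · rw [mpi_of_rel v hxz, mpi_of_rel_swap v hξ hzy]
      have := mpiAux_mono hξ hadm (v := v) (x := x) (.inr rfl) (.inl hzy)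
      have := mpiAux_mono hξ hadm (v := v) (y := y) (.inl hxz) (.inr rfl)
      linarith
  · rw [mpi_of_rel v hyz, mpi_of_rel v (hξ.2.1 x y z hxy hyz)]
    refine (mpiAux_le_max hξ hadm x y z).trans ?_
    rw [h, max_eq_right (mpiAux_nonneg hξ hadm y z)]

/-- Properties of the projected scores and margins with respect to
an admissible order `ξ`: (a) monotonicity inequalities whenever `x ≺ y` and
`z ∉ {x,y}`; (b) if `v^π_{xy} = v^π_{yx}` then those inequalities are
equalities. -/
theorem stmt6 {A : Type*} [Fintype A] [DecidableEq A] (v : A → A → ℝ)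
    (hv : Llull v) (ξ : A → A → Prop) (hξ : StrictTotal ξ) (hadm : Adm v ξ) :
    (∀ x y z, ξ x y → z ≠ x → z ≠ y →
      vpi v ξ x y ≥ vpi v ξ y x ∧ mpi v ξ x y ≥ 0 ∧
      vpi v ξ x z ≥ vpi v ξ y z ∧ vpi v ξ z x ≤ vpi v ξ z y ∧
      mpi v ξ x z ≥ mpi v ξ y z ∧ mpi v ξ z x ≤ mpi v ξ z y) ∧
    (∀ x y z, ξ x y → z ≠ x → z ≠ y → vpi v ξ x y = vpi v ξ y x →
      vpi v ξ x z = vpi v ξ y z ∧ vpi v ξ z x = vpi v ξ z y ∧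
      mpi v ξ x z = mpi v ξ y z ∧ mpi v ξ z x = mpi v ξ z y) := by
  refine ⟨fun x y z hxy hzx hzy => ?_, fun x y z hxy hzx hzy heq => ?_⟩
  all_goals
    have hne : x ≠ y := fun h => hξ.1 x (by simpa [h] using hxy)
    have hyx := mpi_swap v hξ hne
    have hx := mpi_swap v hξ hzx
    have hy := mpi_swap v hξ hzy
  · have := mpi_nonneg hξ hadm hxy
    have := mpi_le_mpi_left hξ hadm hxy hzx hzy
    simp only [vpi]
    refine ⟨?_, ?_, ?_, ?_, ?_, ?_⟩ <;> linarith
  · simp only [vpi] at heq ⊢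
    have := mpi_eq_mpi_left hξ hadm hxy hzx hzy (by linarith)
    refine ⟨?_, ?_, ?_, ?_⟩ <;> linarith
end

section
/- Let v be a complete Llull matrix on a finite set A of N elements, with rank-like rates R. Then for every x ∈ A: (a) R_x = 1 if and only if v_{xy} = 1 for all y ≠ x; (b) R_x = N if and only if v_{xy} = 0 for all y ≠ x. -/
/-! Common definitions: valued relations, indirect scores, admissible orders,
projected margins/scores, rank-like rates (Camps–Mora–Saumell CLC method). -/

variable {A : Type*} [Fintype A] [DecidableEq A]

section LinkScore

variable {α : Type*} {v : α → α → ℝ}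

theorem linkScore_cons_cons_cons (a b c : α) (l : List α) :
    linkScore v (a :: b :: c :: l) = min (v a b) (linkScore v (b :: c :: l)) := rfl

theorem linkScore_le_head (a b : α) (l : List α) : linkScore v (a :: b :: l) ≤ v a b := by
  cases l with
  | nil => exact le_rfl
  | cons c l => exact min_le_left _ _

theorem linkScore_mem_Icc (hv : Llull v) (l : List α) (hl : List.IsChain (· ≠ ·) l) :
    linkScore v l ∈ Set.Icc (0 : ℝ) 1 := by
  induction l with
  | nil => simp [linkScore]
  | cons a l ih =>
    match l, hl, ih with
    | [], _, _ => simp [linkScore]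
    | [b], hl, _ =>
      obtain ⟨h0, h1, -⟩ := hv a b (by simpa using hl)
      exact ⟨h0, h1⟩
    | b :: c :: l, hl, ih =>
      rw [List.isChain_cons_cons] at hl
      obtain ⟨h0, h1, -⟩ := hv a b hl.1
      rw [linkScore_cons_cons_cons]
      exact ⟨le_min h0 (ih hl.2).1, (min_le_left _ _).trans h1⟩

theorem linkScore_append_singleton_nonpos {x : α} (hx : ∀ y, y ≠ x → v y x ≤ 0) (l : List α)
    (a : α) (hl : List.IsChain (· ≠ ·) (a :: (l ++ [x]))) :
    linkScore v (a :: (l ++ [x])) ≤ 0 := by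
  induction l generalizing a with
  | nil => exact hx a (by simpa using hl)
  | cons b l ih =>
    rw [List.cons_append, List.isChain_cons_cons] at hl
    have h := ih b hl.2
    cases l with
    | nil => exact (min_le_right _ _).trans h
    | cons c l => exact (min_le_right _ _).trans h

theorem linkScore_cons_append_nonpos {x : α} (hx : ∀ y, y ≠ x → v x y ≤ 0) (l : List α)
    (y : α) (hl : List.IsChain (· ≠ ·) (x :: (l ++ [y]))) :
    linkScore v (x :: (l ++ [y])) ≤ 0 := by
  cases l with
  | nil => exact hx y (Ne.symm (by simpa using hl))
  | cons b l =>
    rw [List.cons_append, List.isChain_cons_cons] at hl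
    exact (linkScore_le_head _ _ _).trans (hx b hl.1.symm)

end LinkScore

section Istar

variable {α : Type*} {v : α → α → ℝ}

theorem istar_le_of_forall {x y : α} (hxy : x ≠ y) {c : ℝ}
    (h : ∀ l : List α, List.IsChain (· ≠ ·) (x :: (l ++ [y])) →
      linkScore v (x :: (l ++ [y])) ≤ c) : istar v x y ≤ c := by
  refine csSup_le ⟨v x y, [], List.isChain_pair.2 hxy, rfl⟩ ?_
  rintro s ⟨l, hl, rfl⟩
  exact h l hl

theorem istar_le_one (hv : Llull v) {x y : α} (hxy : x ≠ y) : istar v x y ≤ 1 :=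
  istar_le_of_forall hxy fun _ hl => (linkScore_mem_Icc hv _ hl).2

theorem le_istar (hv : Llull v) {x y : α} (hxy : x ≠ y) : v x y ≤ istar v x y := by
  refine le_csSup ⟨1, ?_⟩ ⟨[], List.isChain_pair.2 hxy, rfl⟩
  rintro s ⟨l, hl, rfl⟩
  exact (linkScore_mem_Icc hv _ hl).2

theorem istar_nonneg (hv : Llull v) {x y : α} (hxy : x ≠ y) : 0 ≤ istar v x y :=
  (hv x y hxy).1.trans (le_istar hv hxy)

theorem istar_sub_le_one (hv : Llull v) {x y : α} (hxy : x ≠ y) :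
    istar v x y - istar v y x ≤ 1 := by
  linarith [istar_le_one hv hxy, istar_nonneg hv hxy.symm]

theorem eq_one_of_one_le_istar_sub (hv : Llull v) {x y : α} (hxy : x ≠ y)
    (h : 1 ≤ istar v x y - istar v y x) : v x y = 1 := by
  linarith [istar_le_one hv hxy, le_istar hv hxy.symm, hv x y hxy]

theorem istar_sub_eq_one_of_forall_left (hv : Llull v) {x : α} (hx : ∀ y, y ≠ x → v x y = 1)
    {y : α} (hy : y ≠ x) : istar v x y - istar v y x = 1 := by
  have h0 : istar v y x ≤ 0 := istar_le_of_forall hy fun l hl =>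
    linkScore_append_singleton_nonpos
      (fun z hz => by linarith [hx z hz, (hv z x hz).2.2]) l y hl
  linarith [hx y hy, le_istar hv hy.symm, istar_sub_le_one hv hy.symm]

theorem istar_sub_eq_one_of_forall_right (hv : Llull v) {x : α} (hx : ∀ y, y ≠ x → v x y = 0)
    {y : α} (hy : y ≠ x) : istar v y x - istar v x y = 1 := by
  have h0 : istar v x y ≤ 0 := istar_le_of_forall hy.symm fun l hl =>
    linkScore_cons_append_nonpos (fun z hz => (hx z hz).le) l y hl
  linarith [hx y hy, (hv y x hy).2.2, le_istar hv hy, istar_sub_le_one hv hy]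

end Istar

section Projection

variable {α : Type*} {v : α → α → ℝ} {ξ : α → α → Prop}

theorem StrictTotal.asymm (hξ : StrictTotal ξ) {x y : α} (h : ξ x y) : ¬ ξ y x :=
  fun h' => hξ.1 x (hξ.2.1 x y x h h')

theorem StrictTotal.ne (hξ : StrictTotal ξ) {x y : α} (h : ξ x y) : x ≠ y := by
  rintro rfl
  exact hξ.1 x h

theorem StrictTotal.of_weak (hξ : StrictTotal ξ) {p x y q : α} (hp : ξ p x ∨ p = x)
    (hxy : ξ x y) (hq : ξ y q ∨ q = y) : ξ p q := by
  have hpy : ξ p y := by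
    rcases hp with hp | rfl
    exacts [hξ.2.1 _ _ _ hp hxy, hxy]
  rcases hq with hq | rfl
  exacts [hξ.2.1 _ _ _ hpy hq, hpy]

theorem StrictTotal.exists_immSucc [Finite α] (hξ : StrictTotal ξ) {x y : α} (h : ξ x y) :
    ∃ z, ImmSucc ξ x z := by
  have : IsTrans α ξ := ⟨hξ.2.1⟩
  have : Std.Irrefl ξ := ⟨hξ.1⟩
  obtain ⟨z, hz, hmin⟩ :=
    (Finite.wellFounded_of_trans_of_irrefl ξ).has_min {z | ξ x z} ⟨y, h⟩
  exact ⟨z, hz, fun w hw => hmin w hw.1 hw.2⟩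

theorem StrictTotal.exists_immPred [Finite α] (hξ : StrictTotal ξ) {x y : α} (h : ξ y x) :
    ∃ z, ImmSucc ξ z x := by
  have : IsTrans α (flip ξ) := ⟨fun a b c hab hbc => hξ.2.1 c b a hbc hab⟩
  have : Std.Irrefl (flip ξ) := ⟨hξ.1⟩
  obtain ⟨z, hz, hmin⟩ :=
    (Finite.wellFounded_of_trans_of_irrefl (flip ξ)).has_min {z | ξ z x} ⟨y, h⟩
  exact ⟨z, hz, fun w hw => hmin w hw.2 hw.1⟩

theorem StrictTotal.weak_of_immSucc_left (hξ : StrictTotal ξ) {x x' y : α}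
    (h : ImmSucc ξ x x') (hy : ξ x y) : ξ x' y ∨ y = x' := by
  by_cases hne : y = x'
  · exact .inr hne
  · exact .inl ((hξ.2.2 y x' hne).resolve_left fun h' => h.2 y ⟨hy, h'⟩)

theorem StrictTotal.weak_of_immSucc_right (hξ : StrictTotal ξ) {x x' y : α}
    (h : ImmSucc ξ x x') (hy : ξ y x') : ξ y x ∨ y = x := by
  by_cases hne : y = x
  · exact .inr hne
  · exact .inl ((hξ.2.2 y x hne).resolve_right fun h' => h.2 y ⟨h', hy⟩)

theorem istar_sub_nonneg (hξ : StrictTotal ξ) (hadm : Adm v ξ) {x y : α} (h : ξ x y) :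
    0 ≤ istar v x y - istar v y x := by
  by_contra hlt
  exact hξ.asymm h (hadm y x (by linarith))

theorem msigma_le (hξ : StrictTotal ξ) (hadm : Adm v ξ) {x y p q : α} (h : ξ x y)
    (hp : ξ p x ∨ p = x) (hq : ξ y q ∨ q = y) :
    msigma v ξ x y ≤ istar v p q - istar v q p := by
  refine csInf_le ⟨0, ?_⟩ ⟨p, q, hp, hq, rfl⟩
  rintro s ⟨p, q, hp, hq, rfl⟩
  exact istar_sub_nonneg hξ hadm (hξ.of_weak hp h hq)

theorem le_msigma {x y : α} {c : ℝ}
    (h : ∀ p q, (ξ p x ∨ p = x) → (ξ y q ∨ q = y) → c ≤ istar v p q - istar v q p) :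
    c ≤ msigma v ξ x y := by
  refine le_csInf ⟨_, x, y, .inr rfl, .inr rfl, rfl⟩ ?_
  rintro s ⟨p, q, hp, hq, rfl⟩
  exact h p q hp hq

theorem msigma_mem_Icc (hv : Llull v) (hξ : StrictTotal ξ) (hadm : Adm v ξ) {x y : α}
    (h : ξ x y) : msigma v ξ x y ∈ Set.Icc (0 : ℝ) 1 :=
  ⟨le_msigma fun _ _ hp hq => istar_sub_nonneg hξ hadm (hξ.of_weak hp h hq),
    (msigma_le hξ hadm h (.inr rfl) (.inr rfl)).trans (istar_sub_le_one hv (hξ.ne h))⟩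

theorem mpiAux_mem_Icc (hv : Llull v) (hξ : StrictTotal ξ) (hadm : Adm v ξ) (x y : α) :
    mpiAux v ξ x y ∈ Set.Icc (0 : ℝ) 1 := by
  constructor
  · refine Real.sSup_nonneg ?_
    rintro s ⟨p, q, -, -, h, rfl⟩
    exact (msigma_mem_Icc hv hξ hadm h.1).1
  · refine Real.sSup_le ?_ zero_le_one
    rintro s ⟨p, q, -, -, h, rfl⟩
    exact (msigma_mem_Icc hv hξ hadm h.1).2

theorem msigma_le_mpiAux_s14 (hv : Llull v) (hξ : StrictTotal ξ) (hadm : Adm v ξ) {x y p q : α}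
    (hp : ξ x p ∨ p = x) (hpy : ξ p y) (h : ImmSucc ξ p q) :
    msigma v ξ p q ≤ mpiAux v ξ x y := by
  refine le_csSup ⟨1, ?_⟩ ⟨p, q, hp, hpy, h, rfl⟩
  rintro s ⟨p, q, -, -, h, rfl⟩
  exact (msigma_mem_Icc hv hξ hadm h.1).2

theorem mpiAux_of_immSucc (hξ : StrictTotal ξ) {x y : α} (h : ImmSucc ξ x y) :
    mpiAux v ξ x y = msigma v ξ x y := by
  have hset : {s : ℝ | ∃ p q, (ξ x p ∨ p = x) ∧ ξ p y ∧ ImmSucc ξ p q ∧ s = msigma v ξ p q} =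
      {msigma v ξ x y} := by
    ext s
    constructor
    · rintro ⟨p, q, hp, hpy, hpq, rfl⟩
      obtain rfl : p = x := hp.resolve_left fun h' => h.2 p ⟨h', hpy⟩
      obtain rfl : q = y := by
        by_contra hne
        rcases hξ.2.2 q y hne with h' | h'
        exacts [h.2 q ⟨hpq.1, h'⟩, hpq.2 y ⟨h.1, h'⟩]
      rfl
    · rintro rfl
      exact ⟨x, y, .inr rfl, h.1, h, rfl⟩
  rw [mpiAux, hset, csSup_singleton]

theorem mpi_of_lt {x y : α} (h : ξ x y) : mpi v ξ x y = mpiAux v ξ x y := if_pos h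

theorem mpi_of_gt (hξ : StrictTotal ξ) {x y : α} (h : ξ y x) :
    mpi v ξ x y = -mpiAux v ξ y x := if_neg (hξ.asymm h)

theorem mpi_mem_Icc (hv : Llull v) (hξ : StrictTotal ξ) (hadm : Adm v ξ) (x y : α) :
    mpi v ξ x y ∈ Set.Icc (-1 : ℝ) 1 := by
  obtain ⟨h0, h1⟩ := mpiAux_mem_Icc hv hξ hadm x y
  obtain ⟨h0', h1'⟩ := mpiAux_mem_Icc hv hξ hadm y x
  unfold mpi
  split_ifs <;> constructor <;> linarith

theorem forall_mpi_eq_one_iff [Finite α] (hv : Llull v) (hξ : StrictTotal ξ) (hadm : Adm v ξ)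
    (x : α) : (∀ y, y ≠ x → mpi v ξ x y = 1) ↔ ∀ y, y ≠ x → v x y = 1 := by
  constructor
  · intro h y hy
    have hfirst : ∀ z, z ≠ x → ξ x z := fun z hz => by
      refine (hξ.2.2 x z hz.symm).resolve_right fun hzx => ?_
      linarith [h z hz, mpi_of_gt (v := v) hξ hzx, (mpiAux_mem_Icc hv hξ hadm z x).1]
    obtain ⟨x', hx'⟩ := hξ.exists_immSucc (hfirst y hy)
    have h1 := h x' (hξ.ne hx'.1).symm
    rw [mpi_of_lt hx'.1, mpiAux_of_immSucc hξ hx'] at h1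
    exact eq_one_of_one_le_istar_sub hv hy.symm (h1.ge.trans
      (msigma_le hξ hadm hx'.1 (.inr rfl) (hξ.weak_of_immSucc_left hx' (hfirst y hy))))
  · intro h y hy
    have hm : ∀ z, z ≠ x → istar v x z - istar v z x = 1 := fun z hz =>
      istar_sub_eq_one_of_forall_left hv h hz
    have hfirst : ∀ z, z ≠ x → ξ x z := fun z hz => hadm x z (by linarith [hm z hz])
    obtain ⟨x', hx'⟩ := hξ.exists_immSucc (hfirst y hy)
    rw [mpi_of_lt (hfirst y hy)]
    refine le_antisymm (mpiAux_mem_Icc hv hξ hadm x y).2 (le_trans (le_msigma ?_)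
      (msigma_le_mpiAux_s14 hv hξ hadm (.inr rfl) (hfirst y hy) hx'))
    intro p q hp hq
    obtain rfl : p = x := by
      by_contra hne
      exact hξ.asymm (hfirst p hne) (hp.resolve_right hne)
    exact (hm q (hξ.ne (hξ.of_weak (.inr rfl) hx'.1 hq)).symm).ge

theorem forall_mpi_eq_neg_one_iff [Finite α] (hv : Llull v) (hξ : StrictTotal ξ)
    (hadm : Adm v ξ) (x : α) :
    (∀ y, y ≠ x → mpi v ξ x y = -1) ↔ ∀ y, y ≠ x → v x y = 0 := by
  constructor
  · intro h y hy
    have hlast : ∀ z, z ≠ x → ξ z x := fun z hz => by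
      refine (hξ.2.2 z x hz).resolve_right fun hxz => ?_
      linarith [h z hz, mpi_of_lt (v := v) hxz, (mpiAux_mem_Icc hv hξ hadm x z).1]
    obtain ⟨x', hx'⟩ := hξ.exists_immPred (hlast y hy)
    have h1 := h x' (hξ.ne hx'.1)
    rw [mpi_of_gt hξ hx'.1, mpiAux_of_immSucc hξ hx', neg_inj] at h1
    have h2 := eq_one_of_one_le_istar_sub hv hy (h1.ge.trans
      (msigma_le hξ hadm hx'.1 (hξ.weak_of_immSucc_right hx' (hlast y hy)) (.inr rfl)))
    linarith [(hv x y hy.symm).2.2]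
  · intro h y hy
    have hm : ∀ z, z ≠ x → istar v z x - istar v x z = 1 := fun z hz =>
      istar_sub_eq_one_of_forall_right hv h hz
    have hlast : ∀ z, z ≠ x → ξ z x := fun z hz => hadm z x (by linarith [hm z hz])
    obtain ⟨x', hx'⟩ := hξ.exists_immPred (hlast y hy)
    rw [mpi_of_gt hξ (hlast y hy), neg_inj]
    have hyx' : ξ y x' ∨ x' = y :=
      (hξ.weak_of_immSucc_right hx' (hlast y hy)).imp id Eq.symm
    refine le_antisymm (mpiAux_mem_Icc hv hξ hadm y x).2 (le_trans (le_msigma ?_)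
      (msigma_le_mpiAux_s14 hv hξ hadm hyx' hx'.1 hx'))
    intro p q hp hq
    obtain rfl : q = x := by
      by_contra hne
      exact hξ.asymm (hlast q hne) (hq.resolve_right hne)
    exact (hm p (hξ.ne (hξ.of_weak hp hx'.1 (.inr rfl)))).ge

end Projection

/-- For every `x`: (a) `R_x = 1` iff `v_{xy} = 1` for all
`y ≠ x`; (b) `R_x = N` iff `v_{xy} = 0` for all `y ≠ x`. -/
theorem stmt14 {A : Type*} [Fintype A] [DecidableEq A] (v : A → A → ℝ)
    (hv : Llull v) (ξ : A → A → Prop) (hξ : StrictTotal ξ) (hadm : Adm v ξ)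
    (x : A) :
    (rlr v ξ x = 1 ↔ ∀ y : A, y ≠ x → v x y = 1) ∧
    (rlr v ξ x = (Fintype.card A : ℝ) ↔ ∀ y : A, y ≠ x → v x y = 0) := by
  constructor
  · rw [← forall_mpi_eq_one_iff hv hξ hadm x]
    have hcard : (Fintype.card A : ℝ) - 1 = ∑ y ∈ Finset.univ.erase x, (1 : ℝ) := by
      have := Finset.sum_erase_eq_sub (f := fun _ : A => (1 : ℝ)) (Finset.mem_univ x)
      simpa using this.symm
    have key := Finset.sum_eq_sum_iff_of_le (s := Finset.univ.erase x)
      (f := fun y => vpi v ξ x y) (g := fun _ => (1 : ℝ)) fun y _ => by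
        have := (mpi_mem_Icc hv hξ hadm x y).2
        simp only [vpi]
        linarith
    have hvpi : ∀ y, vpi v ξ x y = 1 ↔ mpi v ξ x y = 1 := fun y => by
      unfold vpi
      constructor <;> intro h <;> linarith
    simp only [← hcard, Finset.mem_erase, Finset.mem_univ, and_true, hvpi] at key
    rw [← key, rlr]
    constructor <;> intro h <;> linarith
  · rw [← forall_mpi_eq_neg_one_iff hv hξ hadm x, rlr, sub_eq_self,
      Finset.sum_eq_zero_iff_of_nonneg fun y _ => by
        have := (mpi_mem_Icc hv hξ hadm x y).1
        unfold vpi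
        linarith]
    have hvpi : ∀ y, vpi v ξ x y = 0 ↔ mpi v ξ x y = -1 := fun y => by
      unfold vpi
      constructor <;> intro h <;> linarith
    simp only [Finset.mem_erase, Finset.mem_univ, and_true, hvpi]
end
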